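/- Let α ∈ (0,1), a ≠ 0, and b₀, y₀ ∈ ℝ. The function y(t) = y₀ E_α(−a t^α) + (b₀/a)(1 − E_α(−a t^α)), where E_α(z) = ∑_{k=0}^∞ z^k/Γ(αk+1) is the Mittag-Leffler function, satisfies y(0) = y₀ and, for every t > 0, the Caputo fractional differential equation (1/Γ(1−α)) ∫₀^t (t−τ)^{−α} y′(τ) dτ + a · y(t) = b₀. -/

import Mathlib

open Filter Topology intervalIntegral

/-- The Mittag-Leffler function `E_α(z) = ∑_{k=0}^∞ z^k / Γ(αk+1)`. -/
noncomputable def mittagLeffler (α z : ℝ) : ℝ :=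
  ∑' k : ℕ, z ^ k / Real.Gamma (α * (k : ℝ) + 1)

theorem Real.rpow_mul_exp_neg_le_Gamma {R s : ℝ} (hR : 0 < R) (hs : 0 ≤ s) :
    R ^ s * Real.exp (-R) ≤ Real.Gamma (s + 1) := by
  have hint := Real.GammaIntegral_convergent (s := s + 1) (by linarith)
  have hsub : Set.Ioi R ⊆ Set.Ioi 0 := Set.Ioi_subset_Ioi hR.le
  rw [Real.Gamma_eq_integral (by linarith), mul_comm, ← integral_exp_neg_Ioi R,
    ← MeasureTheory.integral_mul_const]
  calc ∫ x in Set.Ioi R, Real.exp (-x) * R ^ s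
      ≤ ∫ x in Set.Ioi R, Real.exp (-x) * x ^ (s + 1 - 1) := by
        refine MeasureTheory.setIntegral_mono_on
          ((integrableOn_exp_neg_Ioi R).mul_const _) (hint.mono_set hsub)
          measurableSet_Ioi fun x hx => ?_
        rw [add_sub_cancel_right]
        have hx' : R ≤ x := (Set.mem_Ioi.mp hx).le
        gcongr
    _ ≤ ∫ x in Set.Ioi 0, Real.exp (-x) * x ^ (s + 1 - 1) := by
        refine MeasureTheory.setIntegral_mono_set hint ?_ hsub.eventuallyLE
        filter_upwards [MeasureTheory.ae_restrict_mem measurableSet_Ioi] with x hx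
        have : (0 : ℝ) < x := hx
        positivity

theorem summable_mittagLeffler {α : ℝ} (hα : 0 < α) (z : ℝ) :
    Summable fun k : ℕ => z ^ k / Real.Gamma (α * (k : ℝ) + 1) := by
  set B : ℝ := 2 * |z| + 1 with hB
  have hB0 : 0 < B := by positivity
  set R : ℝ := B ^ α⁻¹ with hRdef
  have hR : 0 < R := by positivity
  have hq : |z| / B < 1 := by
    rw [div_lt_one hB0]
    linarith [abs_nonneg z]
  refine Summable.of_norm_bounded
    ((summable_geometric_of_lt_one (by positivity) hq).mul_left (Real.exp R)) fun k => ?_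
  have hG := Real.rpow_mul_exp_neg_le_Gamma (s := α * k) hR (by positivity)
  have hRk : R ^ (α * (k : ℝ)) = B ^ k := by
    rw [hRdef, ← Real.rpow_mul hB0.le, inv_mul_cancel_left₀ hα.ne', Real.rpow_natCast]
  rw [hRk] at hG
  have hpos : 0 < B ^ k * Real.exp (-R) := by positivity
  rw [norm_div, norm_pow, Real.norm_eq_abs, Real.norm_eq_abs, abs_of_pos (hpos.trans_le hG)]
  calc |z| ^ k / Real.Gamma (α * k + 1) ≤ |z| ^ k / (B ^ k * Real.exp (-R)) := by gcongr
    _ = Real.exp R * (|z| / B) ^ k := by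
      rw [Real.exp_neg, div_pow]
      field_simp

theorem mittagLeffler_zero (α : ℝ) : mittagLeffler α 0 = 1 := by
  rw [mittagLeffler, tsum_eq_single 0 fun k hk => by simp [hk]]
  simp

theorem summable_mittagLeffler_deriv {α : ℝ} (hα : 0 < α) (z : ℝ) :
    Summable fun k : ℕ => (k : ℝ) * z ^ (k - 1) / Real.Gamma (α * (k : ℝ) + 1) := by
  refine Summable.of_norm_bounded (summable_mittagLeffler hα (2 * (|z| + 1))) fun k => ?_
  have hG : 0 < Real.Gamma (α * (k : ℝ) + 1) := Real.Gamma_pos_of_pos (by positivity)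
  rw [norm_div, norm_mul, norm_pow, Real.norm_eq_abs, Real.norm_eq_abs, Real.norm_eq_abs,
    abs_of_pos hG, Nat.abs_cast, mul_pow]
  have h1 : (k : ℝ) ≤ 2 ^ k := by exact_mod_cast Nat.lt_two_pow_self.le
  have h2 : |z| ^ (k - 1) ≤ (|z| + 1) ^ k :=
    (pow_le_pow_left₀ (abs_nonneg z) (by linarith) _).trans
      (pow_le_pow_right₀ (by linarith [abs_nonneg z]) (Nat.sub_le _ _))
  gcongr

theorem hasDerivAt_mittagLeffler {α : ℝ} (hα : 0 < α) (z : ℝ) :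
    HasDerivAt (mittagLeffler α)
      (∑' k : ℕ, (k : ℝ) * z ^ (k - 1) / Real.Gamma (α * (k : ℝ) + 1)) z := by
  refine hasDerivAt_tsum_of_isPreconnected (t := Metric.ball 0 (|z| + 1)) (y₀ := z)
    (g := fun (k : ℕ) (w : ℝ) => w ^ k / Real.Gamma (α * (k : ℝ) + 1))
    (g' := fun (k : ℕ) (w : ℝ) => (k : ℝ) * w ^ (k - 1) / Real.Gamma (α * (k : ℝ) + 1))
    (summable_mittagLeffler_deriv hα (|z| + 1)) Metric.isOpen_ball
    (convex_ball _ _).isPreconnected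
    (fun k w _ => (hasDerivAt_pow k w).div_const _) (fun k w hw => ?_) (by simp)
    (summable_mittagLeffler hα z) (by simp)
  have hG : 0 < Real.Gamma (α * (k : ℝ) + 1) := Real.Gamma_pos_of_pos (by positivity)
  have hw' : |w| ≤ |z| + 1 := by simpa using (Metric.mem_ball.mp hw).le
  rw [norm_div, norm_mul, norm_pow, Real.norm_eq_abs, Real.norm_eq_abs, Real.norm_eq_abs,
    abs_of_pos hG, Nat.abs_cast]
  gcongr

theorem hasSum_deriv_mittagLeffler_comp_rpow {α : ℝ} (hα : 0 < α) (c : ℝ) {u : ℝ} (hu : 0 < u) :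
    HasSum (fun k : ℕ => c ^ (k + 1) * u ^ (α * ((k : ℝ) + 1) - 1) / Real.Gamma (α * ((k : ℝ) + 1)))
      (deriv (fun v : ℝ => mittagLeffler α (c * v ^ α)) u) := by
  have hd := (hasDerivAt_mittagLeffler hα (c * u ^ α)).comp u
    ((Real.hasDerivAt_rpow_const (p := α) (Or.inl hu.ne')).const_mul c)
  have hs := (summable_mittagLeffler_deriv hα (c * u ^ α)).hasSum
  rw [← hasSum_nat_add_iff' 1] at hs
  simp only [Finset.range_one, Finset.sum_singleton, Nat.cast_zero, zero_mul, zero_div,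
    sub_zero] at hs
  have hderiv := hd.deriv
  simp only [Function.comp_def] at hderiv
  rw [hderiv]
  refine (hs.mul_right (c * (α * u ^ (α - 1)))).congr_fun fun k => ?_
  have hk : 0 < α * ((k : ℝ) + 1) := by positivity
  have hG : 0 < Real.Gamma (α * ((k : ℝ) + 1)) := Real.Gamma_pos_of_pos hk
  have hpow : u ^ (α * ((k : ℝ) + 1) - 1) = (u ^ α) ^ k * u ^ (α - 1) := by
    rw [← Real.rpow_mul_natCast hu.le, ← Real.rpow_add hu]
    ring_nf
  push_cast
  rw [Real.Gamma_add_one hk.ne', hpow, mul_pow, pow_succ c]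
  field_simp

theorem integral_sub_rpow_mul_rpow {p q t : ℝ} (hp : 0 < p) (hq : 0 < q) (ht : 0 < t) :
    ∫ τ in (0 : ℝ)..t, (t - τ) ^ (p - 1) * τ ^ (q - 1) =
      t ^ (p + q - 1) * (Real.Gamma p * Real.Gamma q / Real.Gamma (p + q)) := by
  have h := Complex.betaIntegral_scaled (q : ℂ) (p : ℂ) ht
  rw [Complex.betaIntegral_eq_Gamma_mul_div _ _ (by simpa) (by simpa)] at h
  rw [← Complex.ofReal_inj, ← intervalIntegral.integral_ofReal]
  have hcongr : ∫ τ in (0 : ℝ)..t, (((t - τ) ^ (p - 1) * τ ^ (q - 1) : ℝ) : ℂ) =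
      ∫ τ in (0 : ℝ)..t, (τ : ℂ) ^ ((q : ℂ) - 1) * ((t : ℂ) - τ) ^ ((p : ℂ) - 1) := by
    refine intervalIntegral.integral_congr fun τ hτ => ?_
    rw [Set.uIcc_of_le ht.le] at hτ
    rw [Complex.ofReal_mul, Complex.ofReal_cpow (sub_nonneg.mpr hτ.2),
      Complex.ofReal_cpow hτ.1]
    push_cast
    ring
  rw [hcongr, h, Complex.ofReal_mul, Complex.ofReal_cpow ht.le]
  push_cast
  simp only [← Complex.ofReal_add, Complex.Gamma_ofReal]
  push_cast
  rw [add_comm (q : ℂ) p, mul_comm (Real.Gamma q : ℂ), add_comm q p]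

theorem intervalIntegrable_sub_rpow_mul_rpow {p q t : ℝ} (hp : 0 < p) (hq : 0 < q) (ht : 0 < t) :
    IntervalIntegrable (fun τ : ℝ => (t - τ) ^ (p - 1) * τ ^ (q - 1))
      MeasureTheory.volume 0 t := by
  by_contra hnot
  have h := integral_sub_rpow_mul_rpow hp hq ht
  rw [intervalIntegral.integral_undef hnot] at h
  have h1 := Real.Gamma_pos_of_pos hp
  have h2 := Real.Gamma_pos_of_pos hq
  have h3 := Real.Gamma_pos_of_pos (add_pos hp hq)
  have : 0 < t ^ (p + q - 1) * (Real.Gamma p * Real.Gamma q / Real.Gamma (p + q)) := by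
    positivity
  exact this.ne h

/-- The Caputo derivative of order `α` of `t ↦ E_α(c t^α)` is `c E_α(c t^α)`, up to the
normalising factor `Γ(1 - α)`. -/
theorem integral_sub_rpow_mul_deriv_mittagLeffler {α : ℝ} (hα0 : 0 < α) (hα1 : α < 1)
    (c : ℝ) {t : ℝ} (ht : 0 < t) :
    ∫ τ in (0 : ℝ)..t, (t - τ) ^ (-α) * deriv (fun v : ℝ => mittagLeffler α (c * v ^ α)) τ =
      Real.Gamma (1 - α) * (c * mittagLeffler α (c * t ^ α)) := by
  have hp : 0 < 1 - α := sub_pos.mpr hα1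
  have hq : ∀ k : ℕ, 0 < α * ((k : ℝ) + 1) := fun k => by positivity
  have hG : ∀ k : ℕ, 0 < Real.Gamma (α * ((k : ℝ) + 1)) := fun k => Real.Gamma_pos_of_pos (hq k)
  let G : ℝ → ℕ → ℝ → ℝ := fun d k τ => d ^ (k + 1) / Real.Gamma (α * ((k : ℝ) + 1)) *
    ((t - τ) ^ (1 - α - 1) * τ ^ (α * ((k : ℝ) + 1) - 1))
  have hint : ∀ d k, IntervalIntegrable (G d k) MeasureTheory.volume 0 t := fun d k =>
    (intervalIntegrable_sub_rpow_mul_rpow hp (hq k) ht).const_mul _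
  have hval : ∀ d k, ∫ τ in (0 : ℝ)..t, G d k τ = Real.Gamma (1 - α) * d *
      ((d * t ^ α) ^ k / Real.Gamma (α * (k : ℝ) + 1)) := fun d k => by
    have hk : 1 - α + α * ((k : ℝ) + 1) = α * k + 1 := by ring
    have hGk := (hG k).ne'
    simp only [G]
    rw [intervalIntegral.integral_const_mul, integral_sub_rpow_mul_rpow hp (hq k) ht, hk,
      add_sub_cancel_right, Real.rpow_mul_natCast ht.le, mul_pow, pow_succ]
    field_simp
  have hnorm : ∀ k, ∫ τ in Set.Ioc 0 t, ‖G c k τ‖ = Real.Gamma (1 - α) * |c| *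
      ((|c| * t ^ α) ^ k / Real.Gamma (α * (k : ℝ) + 1)) := fun k => by
    rw [← hval, intervalIntegral.integral_of_le ht.le]
    refine MeasureTheory.setIntegral_congr_fun measurableSet_Ioc fun τ hτ => ?_
    have h1 : 0 ≤ (t - τ) ^ (1 - α - 1) := Real.rpow_nonneg (sub_nonneg.mpr hτ.2) _
    have h2 : 0 ≤ τ ^ (α * ((k : ℝ) + 1) - 1) := Real.rpow_nonneg hτ.1.le _
    simp only [G]
    rw [norm_mul, norm_div, norm_pow, Real.norm_of_nonneg (hG k).le,
      Real.norm_of_nonneg (mul_nonneg h1 h2), Real.norm_eq_abs]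
  have hsum := MeasureTheory.hasSum_integral_of_summable_integral_norm
    (μ := MeasureTheory.volume.restrict (Set.Ioc 0 t)) (F := G c)
    (fun k => (intervalIntegrable_iff_integrableOn_Ioc_of_le ht.le).mp (hint c k))
    (by simpa only [hnorm] using (summable_mittagLeffler hα0 (|c| * t ^ α)).mul_left _)
  have hinteg : ∫ τ in Set.Ioc 0 t, ∑' k, G c k τ = ∫ τ in (0 : ℝ)..t,
      (t - τ) ^ (-α) * deriv (fun v : ℝ => mittagLeffler α (c * v ^ α)) τ := by
    rw [intervalIntegral.integral_of_le ht.le]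
    refine MeasureTheory.setIntegral_congr_fun measurableSet_Ioc fun τ hτ => ?_
    refine HasSum.tsum_eq (((hasSum_deriv_mittagLeffler_comp_rpow hα0 c hτ.1).mul_left
      ((t - τ) ^ (-α))).congr_fun fun k => ?_)
    simp only [G]
    rw [show 1 - α - 1 = -α by ring]
    ring
  simp only [← intervalIntegral.integral_of_le ht.le (f := G c _), hval] at hsum
  rw [← hinteg, ← mul_assoc]
  exact hsum.unique ((summable_mittagLeffler hα0 (c * t ^ α)).hasSum.mul_left _)

/-- The function `y(t) = y₀ E_α(-a t^α) + (b₀/a)(1 - E_α(-a t^α))` satisfies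
`y(0) = y₀` and solves the Caputo fractional ODE `^C D^α y(t) + a y(t) = b₀`
for every `t > 0`. -/
theorem caputo_constant_forcing_solution
    (α a b₀ y₀ : ℝ) (hα0 : 0 < α) (hα1 : α < 1) (ha : a ≠ 0) :
    (y₀ * mittagLeffler α (-a * (0 : ℝ) ^ α)
        + (b₀ / a) * (1 - mittagLeffler α (-a * (0 : ℝ) ^ α)) = y₀)
    ∧ ∀ t : ℝ, 0 < t →
        (1 / Real.Gamma (1 - α)) *
            (∫ τ in (0 : ℝ)..t, (t - τ) ^ (-α) *
              deriv (fun u : ℝ => y₀ * mittagLeffler α (-a * u ^ α)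
                + (b₀ / a) * (1 - mittagLeffler α (-a * u ^ α))) τ)
          + a * (y₀ * mittagLeffler α (-a * t ^ α)
              + (b₀ / a) * (1 - mittagLeffler α (-a * t ^ α)))
          = b₀ := by
  refine ⟨by simp [Real.zero_rpow hα0.ne', mittagLeffler_zero], fun t ht => ?_⟩
  have hderiv : (deriv fun u : ℝ => y₀ * mittagLeffler α (-a * u ^ α)
      + (b₀ / a) * (1 - mittagLeffler α (-a * u ^ α))) =
      fun τ => (y₀ - b₀ / a) * deriv (fun u : ℝ => mittagLeffler α (-a * u ^ α)) τ := by
    funext τ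
    rw [← deriv_const_mul_field,
      ← deriv_add_const (f := fun u => (y₀ - b₀ / a) * mittagLeffler α (-a * u ^ α)) (b₀ / a)]
    congr 1
    funext u
    ring
  have hG : Real.Gamma (1 - α) ≠ 0 := (Real.Gamma_pos_of_pos (sub_pos.mpr hα1)).ne'
  simp only [hderiv, mul_left_comm _ (y₀ - b₀ / a)]
  rw [intervalIntegral.integral_const_mul,
    integral_sub_rpow_mul_deriv_mittagLeffler hα0 hα1 (-a) ht]
  field_simp
  ring
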